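/- Let D be a triangulated category and define, for strictly full subcategories closed under finite direct sums, A ◇ B := smd(A ⋆ B). Then ◇ is associative: (A ◇ B) ◇ C = A ◇ (B ◇ C) for all strictly full subcategories A, B, C of D closed under finite direct sums; moreover A₁ ◇ A₂ ◇ ⋯ ◇ Aₙ = smd(A₁ ⋆ A₂ ⋆ ⋯ ⋆ Aₙ). -/

import Mathlib

/- STATEMENT 8: the operation A ◇ B := smd(A ⋆ B) on strictly full subcategories
closed under finite direct sums is associative, and
A₁ ◇ ⋯ ◇ Aₙ = smd(A₁ ⋆ ⋯ ⋆ Aₙ).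
-/

open CategoryTheory Limits Pretriangulated Opposite

universe v u

variable {C : Type u} [Category.{v} C] [HasZeroObject C] [Preadditive C]
  [HasShift C ℤ] [∀ n : ℤ, (shiftFunctor C n).Additive] [Pretriangulated C]

/-- `Y` is a direct sum of `X` and `Z`. -/
def IsDirectSumOf (Y X Z : C) : Prop :=
  ∃ (i : X ⟶ Y) (j : Z ⟶ Y) (p : Y ⟶ X) (q : Y ⟶ Z),
    i ≫ p = 𝟙 X ∧ j ≫ q = 𝟙 Z ∧ i ≫ q = 0 ∧ j ≫ p = 0 ∧ p ≫ i + q ≫ j = 𝟙 Y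

/-- `X` is a direct summand of `Y`. -/
def IsSummand (X Y : C) : Prop := ∃ Z : C, IsDirectSumOf Y X Z

/-- `smd A`: closure of a class of objects under direct summands. -/
def smd (A : Set C) : Set C := {X | ∃ Y ∈ A, IsSummand X Y}

/-- `A ⋆ B`: objects `X` fitting in a distinguished triangle `A → X → B`. -/
def star (A B : Set C) : Set C :=
  {X | ∃ (a b : C) (_ : a ∈ A) (_ : b ∈ B) (f : a ⟶ X) (g : X ⟶ b) (h : b ⟶ a⟦(1 : ℤ)⟧),
    Triangle.mk f g h ∈ distTriang C}

/-- a class of objects is strictly full (as a full subcategory) if it is closed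
under isomorphism. -/
def IsoClosed (A : Set C) : Prop := ∀ ⦃X Y : C⦄, (X ≅ Y) → X ∈ A → Y ∈ A

/-- a class of objects is closed under finite direct sums. -/
def SumClosed (A : Set C) : Prop :=
  ∀ ⦃X Z Y : C⦄, IsDirectSumOf Y X Z → X ∈ A → Z ∈ A → Y ∈ A


/-- `A ◇ B := smd (A ⋆ B)`. -/
def diamond (A B : Set C) : Set C := smd (star A B)

/-- left fold of `◇` over a list: `diamondFold A [B, C, ...] = (...(A ◇ B) ◇ C) ◇ ...`. -/
def diamondFold (A : Set C) : List (Set C) → Set C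
  | [] => A
  | B :: L => diamondFold (diamond A B) L

/-- left fold of `⋆` over a list: `starFold A [B, C, ...] = (...(A ⋆ B) ⋆ C) ⋆ ...`. -/
def starFold (A : Set C) : List (Set C) → Set C
  | [] => A
  | B :: L => starFold (star A B) L

/-- In a pretriangulated category, direct summands and retracts are the same thing. -/
theorem isSummand_iff_nonempty_retract (X Y : C) : IsSummand X Y ↔ Nonempty (Retract X Y) := by
  constructor
  · rintro ⟨Z, i, j, p, q, hip, -⟩
    exact ⟨⟨i, p, hip⟩⟩
  · rintro ⟨⟨i, r, hir⟩⟩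
    obtain ⟨Z, q, w, hT⟩ := distinguished_cocone_triangle i
    have : IsSplitMono i := ⟨⟨r, hir⟩⟩
    have hw : w = 0 := Triangle.mor₃_eq_zero_of_mono₁ _ hT (inferInstanceAs (Mono i))
    have hiq : i ≫ q = 0 := comp_distTriang_mor_zero₁₂ _ hT
    obtain ⟨s, hs⟩ : ∃ s : Z ⟶ Y, 𝟙 Z = s ≫ q :=
      Triangle.coyoneda_exact₃ _ hT (𝟙 Z) (by subst hw; exact comp_zero)
    have hjq : (s - s ≫ r ≫ i) ≫ q = 𝟙 Z := by simp [hiq, ← hs]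
    have hjr : (s - s ≫ r ≫ i) ≫ r = 0 := by simp [hir]
    refine ⟨Z, i, s - s ≫ r ≫ i, r, q, hir, hjq, hiq, hjr, ?_⟩
    obtain ⟨t, ht⟩ : ∃ t : Y ⟶ X, 𝟙 Y - (r ≫ i + q ≫ (s - s ≫ r ≫ i)) = t ≫ i :=
      Triangle.coyoneda_exact₂ _ hT _ (by
        change (𝟙 Y - (r ≫ i + q ≫ (s - s ≫ r ≫ i))) ≫ q = 0
        simp only [Preadditive.sub_comp _ (r ≫ i + _), Preadditive.add_comp, Category.assoc, hjq,
          hiq, Category.id_comp, Category.comp_id, comp_zero, zero_add, sub_self])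
    have ht0 : t = 0 := by
      have h := congrArg (· ≫ r) ht
      simp only [Preadditive.sub_comp _ (r ≫ i + _), Preadditive.add_comp, Category.assoc, hjr,
        hir, Category.id_comp, Category.comp_id, comp_zero, add_zero, sub_self] at h
      exact h.symm
    rw [ht0, zero_comp, sub_eq_zero] at ht
    exact ht.symm

theorem smd_eq_retractClosure (A : Set C) :
    smd A = {X | ObjectProperty.retractClosure (fun Y => Y ∈ A) X} := by
  ext X
  simp [smd, ObjectProperty.prop_retractClosure_iff, isSummand_iff_nonempty_retract]

theorem star_eq_extensionProduct (A B : Set C) :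
    star A B = {X | ObjectProperty.extensionProduct (fun Y => Y ∈ A) (fun Y => Y ∈ B) X} := by
  ext X
  constructor
  · rintro ⟨a, b, ha, hb, f, g, h, hT⟩
    exact ⟨a, b, f, g, h, hT, ha, hb⟩
  · rintro ⟨a, b, f, g, h, hT, ha, hb⟩
    exact ⟨a, b, ha, hb, f, g, h, hT⟩

theorem star_assoc [IsTriangulated C] (A B D : Set C) :
    star (star A B) D = star A (star B D) := by
  simp only [star_eq_extensionProduct, Set.mem_ofPred_eq]
  exact congrArg (fun P : ObjectProperty C => {X | P X})
    (ObjectProperty.extensionProduct_assoc _ _ _)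

theorem smd_smd (A : Set C) : smd (smd A) = smd A := by
  simp only [smd_eq_retractClosure, Set.mem_ofPred_eq]
  exact congrArg (fun P : ObjectProperty C => {X | P X})
    (ObjectProperty.retractClosure_retractClosure _)

theorem smd_star_smd_smd (A B : Set C) : smd (star (smd A) (smd B)) = smd (star A B) := by
  simp only [smd_eq_retractClosure, star_eq_extensionProduct, Set.mem_ofPred_eq]
  exact congrArg (fun P : ObjectProperty C => {X | P X})
    (ObjectProperty.retractClosure_extensionProduct_retractClosure_retractClosure _ _)

theorem diamond_smd_left (A B : Set C) : diamond (smd A) B = diamond A B := by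
  rw [diamond, ← smd_star_smd_smd, smd_smd, smd_star_smd_smd, diamond]

theorem diamond_smd_right (A B : Set C) : diamond A (smd B) = diamond A B := by
  rw [diamond, ← smd_star_smd_smd, smd_smd, smd_star_smd_smd, diamond]

theorem diamondFold_smd (A : Set C) (L : List (Set C)) :
    diamondFold (smd A) L = smd (starFold A L) := by
  induction L generalizing A with
  | nil => rfl
  | cons B L ih =>
    rw [diamondFold, diamond_smd_left, diamond, ih, starFold]

theorem diamond_assoc_and_fold [IsTriangulated C] :
    (∀ A B D : Set C, IsoClosed A → IsoClosed B → IsoClosed D →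
      SumClosed A → SumClosed B → SumClosed D →
      diamond (diamond A B) D = diamond A (diamond B D)) ∧
    (∀ (A B : Set C) (L : List (Set C)),
      IsoClosed A → IsoClosed B → (∀ D ∈ L, IsoClosed D) →
      SumClosed A → SumClosed B → (∀ D ∈ L, SumClosed D) →
      diamondFold (diamond A B) L = smd (starFold (star A B) L)) := by
  refine ⟨fun A B D _ _ _ _ _ _ => ?_, fun A B L _ _ _ _ _ _ => diamondFold_smd _ L⟩
  rw [diamond.eq_def A B, diamond.eq_def B D, diamond_smd_left, diamond_smd_right, diamond,
    star_assoc, diamond]
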